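/- arXiv:2404.00683 — 7 statements merged into one kernel-verified Lean document; each statement's English description precedes it below -/
import Mathlib

section
/- If F is a pliable set family on a finite set V, then for any edge set I on V the residual family F^I = {S ∈ F : d_I(S) = 0} is pliable. -/
open scoped Classical

namespace SFEC

variable {V : Type*}

/-- An edge (an unordered pair of distinct elements) `e` covers a set `S`
if exactly one endpoint of `e` lies in `S`. -/
def Covers (e : Sym2 V) (S : Set V) : Prop :=
  ∃ u v : V, e = s(u, v) ∧ u ∈ S ∧ v ∉ S

/-- `delta I S` is the set of edges of `I` with exactly one endpoint in `S`. -/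
noncomputable def delta (I : Finset (Sym2 V)) (S : Set V) : Finset (Sym2 V) :=
  I.filter (fun e => Covers e S)

/-- `d I S = |delta I S|`. -/
noncomputable def d (I : Finset (Sym2 V)) (S : Set V) : ℕ := (delta I S).card

/-- A set family on `V`: a collection of subsets with `∅ ∉ F` and `V ∉ F`. -/
def IsSetFamily (F : Set (Set V)) : Prop := ∅ ∉ F ∧ Set.univ ∉ F

/-- `I` covers the family `F` if it covers every member of `F`. -/
def CoversFam (I : Finset (Sym2 V)) (F : Set (Set V)) : Prop := ∀ S ∈ F, 1 ≤ d I S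

/-- `I` is an inclusion-minimal cover of `F`. -/
def MinimalCover (I : Finset (Sym2 V)) (F : Set (Set V)) : Prop :=
  CoversFam I F ∧ ∀ J : Finset (Sym2 V), J ⊂ I → ¬ CoversFam J F

/-- At least two of the four statements hold. -/
def AtLeastTwo (p q r s : Prop) : Prop :=
  (p ∧ q) ∨ (p ∧ r) ∨ (p ∧ s) ∨ (q ∧ r) ∨ (q ∧ s) ∨ (r ∧ s)

/-- A family is pliable if for all `A, B ∈ F` at least two of the four sets
`A ∩ B, A ∪ B, A \ B, B \ A` belong to `F`. -/
def Pliable (F : Set (Set V)) : Prop :=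
  ∀ A ∈ F, ∀ B ∈ F, AtLeastTwo (A ∩ B ∈ F) (A ∪ B ∈ F) (A \ B ∈ F) (B \ A ∈ F)

/-- The residual family `F^I`: the members of `F` covered by no edge of `I`. -/
def Residual (F : Set (Set V)) (I : Finset (Sym2 V)) : Set (Set V) := {S ∈ F | d I S = 0}

/-- `A` and `B` cross if `A ∩ B`, `A \ B`, `B \ A` and `V \ (A ∪ B)` are all nonempty. -/
def Crosses (A B : Set V) : Prop :=
  (A ∩ B).Nonempty ∧ (A \ B).Nonempty ∧ (B \ A).Nonempty ∧ ((A ∪ B)ᶜ : Set V).Nonempty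

/-- An `F`-core: an inclusion-minimal member of `F`. -/
def Core (F : Set (Set V)) (C : Set V) : Prop := C ∈ F ∧ ∀ A ∈ F, A ⊆ C → A = C

/-- Property (γ). -/
def PropertyGamma (F : Set (Set V)) : Prop :=
  ∀ (J : Finset (Sym2 V)) (S₁ S₂ C : Set V),
    S₁ ∈ Residual F J → S₂ ∈ Residual F J → S₁ ⊂ S₂ →
    Core (Residual F J) C → Crosses C S₁ → Crosses C S₂ →
    S₂ \ (S₁ ∪ C) = ∅ ∨ S₂ \ (S₁ ∪ C) ∈ Residual F J

/-- `F` is γ-pliable: pliable and satisfying Property (γ). -/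
def GammaPliable (F : Set (Set V)) : Prop := Pliable F ∧ PropertyGamma F

/-- `S` is a witness set for the edge `e ∈ I` if `δ_I(S) = {e}`. -/
def WitnessSet (F : Set (Set V)) (I : Finset (Sym2 V)) (S : Set V) (e : Sym2 V) : Prop :=
  S ∈ F ∧ delta I S = {e}

/-- `L ⊆ F` is a witness family for `I`: `|L| = |I|` and each `e ∈ I` has a witness set in `L`. -/
def WitnessFamily (F : Set (Set V)) (I : Finset (Sym2 V)) (L : Finset (Set V)) : Prop :=
  ↑L ⊆ F ∧ L.card = I.card ∧ ∀ e ∈ I, ∃ S ∈ L, WitnessSet F I S e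

/-- A family is laminar if any two members are disjoint or one contains the other. -/
def Laminar (L : Finset (Set V)) : Prop :=
  ∀ A ∈ L, ∀ B ∈ L, A ⊆ B ∨ B ⊆ A ∨ Disjoint A B

/-- `S ∈ L` owns `C` if `S` is the inclusion-minimal member of `L` containing `C`. -/
def Owns (L : Finset (Set V)) (S C : Set V) : Prop :=
  S ∈ L ∧ C ⊆ S ∧ ∀ T ∈ L, C ⊆ T → S ⊆ T

/-- `S ∈ L` is hollow if it owns no `F`-core. -/
def Hollow (F : Set (Set V)) (L : Finset (Set V)) (S : Set V) : Prop :=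
  S ∈ L ∧ ∀ C : Set V, Core F C → ¬ Owns L S C

/-- `A` is the unique child of `S` in `L`: the unique maximal member of `L`
properly contained in `S`. -/
def UniqueChild (L : Finset (Set V)) (A S : Set V) : Prop :=
  A ∈ L ∧ A ⊂ S ∧ ∀ B ∈ L, B ⊂ S → B ⊆ A

/-- `(S 0, S 1, …, S ℓ)` is a hollow chain in `L`. -/
def HollowChain (F : Set (Set V)) (L : Finset (Set V)) (S : ℕ → Set V) (ℓ : ℕ) : Prop :=
  (∀ i ≤ ℓ, S i ∈ L) ∧
  (∀ i, 1 ≤ i → i ≤ ℓ → Hollow F L (S i)) ∧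
  S ℓ ≠ Set.univ ∧
  (∀ i, 1 ≤ i → i ≤ ℓ → UniqueChild L (S (i - 1)) (S i))

/-- `U`: the union of all `F`-cores. -/
def coreUnion (F : Set (Set V)) : Set V := ⋃₀ {C | Core F C}

/-- `F` is uncrossable. -/
def Uncrossable (F : Set (Set V)) : Prop :=
  ∀ A ∈ F, ∀ B ∈ F, (A ∩ B ∈ F ∧ A ∪ B ∈ F) ∨ (A \ B ∈ F ∧ B \ A ∈ F)

/-- `F` is semi-uncrossable. -/
def SemiUncrossable (F : Set (Set V)) : Prop :=
  ∀ A ∈ F, ∀ B ∈ F,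
    (A ∩ B ∈ F ∧ (A ∪ B ∈ F ∨ A \ B ∈ F ∨ B \ A ∈ F)) ∨ (A \ B ∈ F ∧ B \ A ∈ F)

end SFEC

open SFEC

theorem SFEC.d_eq_zero_iff {V : Type*} (I : Finset (Sym2 V)) (S : Set V) :
    d I S = 0 ↔ ∀ u v : V, s(u, v) ∈ I → (u ∈ S ↔ v ∈ S) := by
  rw [d, delta, Finset.card_eq_zero, Finset.filter_eq_empty_iff]
  constructor
  · intro h u v huv
    constructor
    · intro hu
      by_contra hv
      exact h huv ⟨u, v, rfl, hu, hv⟩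
    · intro hv
      by_contra hu
      exact h huv ⟨v, u, Sym2.eq_swap, hv, hu⟩
  · rintro h e he ⟨u, v, rfl, hu, hv⟩
    exact hv ((h u v he).1 hu)

theorem stmt_1 {V : Type*} [Fintype V]
    (F : Set (Set V)) (hF : IsSetFamily F) (hP : Pliable F)
    (I : Finset (Sym2 V)) (hIe : ∀ e ∈ I, ¬ e.IsDiag) :
    Pliable (Residual F I) := by
  rintro A ⟨hA, hdA⟩ B ⟨hB, hdB⟩
  rw [SFEC.d_eq_zero_iff] at hdA hdB
  have h_inter : d I (A ∩ B) = 0 :=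
    (SFEC.d_eq_zero_iff I _).2 fun u v h => and_congr (hdA u v h) (hdB u v h)
  have h_union : d I (A ∪ B) = 0 :=
    (SFEC.d_eq_zero_iff I _).2 fun u v h => or_congr (hdA u v h) (hdB u v h)
  have h_diff : d I (A \ B) = 0 :=
    (SFEC.d_eq_zero_iff I _).2 fun u v h => and_congr (hdA u v h) (not_congr (hdB u v h))
  have h_diff' : d I (B \ A) = 0 :=
    (SFEC.d_eq_zero_iff I _).2 fun u v h => and_congr (hdB u v h) (not_congr (hdA u v h))
  simpa [Residual, h_inter, h_union, h_diff, h_diff'] using hP A hA B hB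
end

section
/- Let F be a pliable set family on a finite set V, let A ∈ F, and let C be an F-core. Then either C ⊆ A, or C ∩ A = ∅, or both A \ C ∈ F and A ∪ C ∈ F. -/
open scoped Classical

open SFEC

theorem stmt_3 {V : Type*} [Fintype V]
    (F : Set (Set V)) (hF : IsSetFamily F) (hP : Pliable F)
    (A : Set V) (hA : A ∈ F) (C : Set V) (hC : Core F C) :
    C ⊆ A ∨ C ∩ A = ∅ ∨ (A \ C ∈ F ∧ A ∪ C ∈ F) := by
  by_cases hsub : C ⊆ A
  · exact Or.inl hsub
  by_cases hdisj : C ∩ A = ∅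
  · exact Or.inr (Or.inl hdisj)
  have hinter : A ∩ C ∉ F := fun h =>
    hsub (Set.inter_eq_right.mp (hC.2 _ h Set.inter_subset_right))
  have hdiff : C \ A ∉ F := fun h =>
    hdisj (sdiff_eq_left.mp (hC.2 _ h Set.sdiff_subset)).eq_bot
  have h := hP A hA C hC.1
  unfold AtLeastTwo at h
  tauto
end

section
/- Let F be a pliable set family on a finite set V. Then any two distinct F-cores are disjoint. -/
open scoped Classical

open SFEC

theorem stmt_4 {V : Type*} [Fintype V]
    (F : Set (Set V)) (hF : IsSetFamily F) (hP : Pliable F)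
    (C₁ C₂ : Set V) (hC₁ : Core F C₁) (hC₂ : Core F C₂) (hne : C₁ ≠ C₂) :
    Disjoint C₁ C₂ := by
  have inter : C₁ ∩ C₂ ∉ F := fun h =>
    hne ((hC₁.2 _ h Set.inter_subset_left).symm.trans (hC₂.2 _ h Set.inter_subset_right))
  have left : C₁ \ C₂ ∈ F → Disjoint C₁ C₂ := fun h =>
    sdiff_eq_left.mp (hC₁.2 _ h Set.sdiff_subset)
  have right : C₂ \ C₁ ∈ F → Disjoint C₁ C₂ := fun h =>
    (sdiff_eq_left.mp (hC₂.2 _ h Set.sdiff_subset)).symm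
  have two := hP C₁ hC₁.1 C₂ hC₂.1
  unfold AtLeastTwo at two
  tauto
end

section
/- Let F be a pliable set family on a finite set V, let I be an inclusion-minimal cover of F, and let A, B ∈ F be witness sets of distinct edges e, f ∈ I respectively, where A and B overlap (i.e., A ∩ B, A \ B, and B \ A are all nonempty). Then one of the four sets A ∩ B, A ∪ B, A \ B, B \ A belongs to F and is a witness set for e or for f. -/
open scoped Classical

open SFEC

theorem covers_mk_iff {V : Type*} (u v : V) (S : Set V) :
    Covers s(u, v) S ↔ ¬(u ∈ S ↔ v ∈ S) := by
  constructor
  · rintro ⟨a, b, hab, ha, hb⟩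
    rcases Sym2.eq_iff.mp hab with ⟨rfl, rfl⟩ | ⟨rfl, rfl⟩ <;> tauto
  · intro h
    by_cases hu : u ∈ S
    · exact ⟨u, v, rfl, hu, by tauto⟩
    · exact ⟨v, u, Sym2.eq_swap, by tauto, hu⟩

/-- An edge covering one of the four corner sets of `A` and `B` covers `A` or `B`. -/
theorem Covers.of_corner {V : Type*} {A B X : Set V} {g : Sym2 V}
    (hX : X ∈ ({A ∩ B, A ∪ B, A \ B, B \ A} : Set (Set V))) (hg : Covers g X) :
    Covers g A ∨ Covers g B := by
  obtain ⟨u, v, rfl, hu, hv⟩ := hg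
  simp only [covers_mk_iff]
  rcases hX with rfl | rfl | rfl | rfl <;>
    simp only [Set.mem_inter_iff, Set.mem_union, Set.mem_sdiff] at hu hv <;> tauto

/-- A member of `F` covered by no edges of `I` besides `e` and `f` is a witness set for one of
them, unless both cover it. -/
theorem covers_both_of_not_witnessSet {V : Type*} {F : Set (Set V)} {I : Finset (Sym2 V)}
    (hI : CoversFam I F) {e f : Sym2 V} (he : e ∈ I) (hf : f ∈ I) {X : Set V} (hXF : X ∈ F)
    (hX : ∀ g ∈ I, Covers g X → g = e ∨ g = f)
    (hn : ¬(WitnessSet F I X e ∨ WitnessSet F I X f)) : Covers e X ∧ Covers f X := by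
  obtain ⟨g, hg⟩ := Finset.card_pos.mp (hI X hXF)
  obtain ⟨hgI, hgX⟩ := Finset.mem_filter.mp hg
  have singleton {p q : Sym2 V} (hp : p ∈ I) (hpX : Covers p X) (hqX : ¬Covers q X)
      (h : ∀ g ∈ I, Covers g X → g = p ∨ g = q) : WitnessSet F I X p := by
    refine ⟨hXF, Finset.ext fun g => ?_⟩
    simp only [delta, Finset.mem_filter, Finset.mem_singleton]
    constructor
    · rintro ⟨hg, hgX⟩
      rcases h g hg hgX with rfl | rfl
      · rfl
      · exact absurd hgX hqX
    · rintro rfl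
      exact ⟨hp, hpX⟩
  by_contra hc
  rcases hX g hgI hgX with rfl | rfl
  · exact hn (.inl (singleton he hgX (fun h => hc ⟨hgX, h⟩) hX))
  · exact hn (.inr (singleton hf hgX (fun h => hc ⟨h, hgX⟩) fun k hk h => (hX k hk h).symm))

theorem stmt_5 {V : Type*} [Fintype V]
    (F : Set (Set V)) (hF : IsSetFamily F) (hP : Pliable F)
    (I : Finset (Sym2 V)) (hIe : ∀ e ∈ I, ¬ e.IsDiag) (hmin : MinimalCover I F)
    (e f : Sym2 V) (he : e ∈ I) (hf : f ∈ I) (hef : e ≠ f)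
    (A B : Set V) (hAe : WitnessSet F I A e) (hBf : WitnessSet F I B f)
    (hover : (A ∩ B).Nonempty ∧ (A \ B).Nonempty ∧ (B \ A).Nonempty) :
    ∃ X ∈ ({A ∩ B, A ∪ B, A \ B, B \ A} : Set (Set V)),
      WitnessSet F I X e ∨ WitnessSet F I X f := by
  obtain ⟨hA, hAd⟩ := hAe
  obtain ⟨hB, hBd⟩ := hBf
  have covA (g : Sym2 V) (hg : g ∈ I) : Covers g A ↔ g = e := by
    simpa [delta, hg] using Finset.ext_iff.mp hAd g
  have covB (g : Sym2 V) (hg : g ∈ I) : Covers g B ↔ g = f := by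
    simpa [delta, hg] using Finset.ext_iff.mp hBd g
  by_contra! hn
  have both (X : Set V) (hX : X ∈ ({A ∩ B, A ∪ B, A \ B, B \ A} : Set (Set V)))
      (hXF : X ∈ F) : Covers e X ∧ Covers f X := by
    refine covers_both_of_not_witnessSet hmin.1 he hf hXF (fun g hg hgX => ?_)
      (not_or.mpr (hn X hX))
    exact (Covers.of_corner hX hgX).imp (covA g hg).mp (covB g hg).mp
  have heA := (covA e he).mpr rfl
  have heB := mt (covB e he).mp hef
  have hfB := (covB f hf).mpr rfl
  have hfA := mt (covA f hf).mp hef.symm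
  have h₁ := both (A ∩ B) (by simp)
  have h₂ := both (A ∪ B) (by simp)
  have h₃ := both (A \ B) (by simp)
  have h₄ := both (B \ A) (by simp)
  have hAB := hP A hA B hB
  clear both hn covA covB
  induction e with | _ a b
  induction f with | _ c d
  simp only [covers_mk_iff, Set.mem_inter_iff, Set.mem_union, Set.mem_sdiff] at *
  unfold AtLeastTwo at hAB
  clear hef hAd hBd hmin hP he hf hA hB
  grind
end

section
/- Let F be a pliable set family on a finite set V and let I be an inclusion-minimal cover of F. Then there exists a witness family L ⊆ F for I that is laminar. -/
open scoped Classical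

open SFEC

namespace SFEC

/-- Two sets are laminar if they are disjoint or one contains the other. -/
def LaminarPair {V : Type*} (A B : Set V) : Prop := A ⊆ B ∨ B ⊆ A ∨ Disjoint A B

/-- `Y` is one of the sets `A ∩ B`, `A ∪ B`, `A \ B`, `B \ A`. -/
def IsCorner {V : Type*} (A B Y : Set V) : Prop :=
  Y = A ∩ B ∨ Y = A ∪ B ∨ Y = A \ B ∨ Y = B \ A

section

variable {V : Type*} {F : Set (Set V)} {I : Finset (Sym2 V)}

theorem LaminarPair.symm {A B : Set V} (h : LaminarPair A B) : LaminarPair B A := by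
  rcases h with h | h | h
  · exact Or.inr (Or.inl h)
  · exact Or.inl h
  · exact Or.inr (Or.inr h.symm)

theorem LaminarPair.refl (A : Set V) : LaminarPair A A := Or.inl subset_rfl

theorem IsCorner.laminarPair {A B Y : Set V} (h : IsCorner A B Y) : LaminarPair Y B := by
  simp only [LaminarPair, Set.disjoint_left, Set.subset_def]
  rcases h with rfl | rfl | rfl | rfl <;> grind

/-- A set that overlaps neither of two overlapping sets overlaps none of their corners. -/
theorem LaminarPair.corner {A B Y Z : Set V} (hAB : ¬ LaminarPair A B) (hY : IsCorner A B Y)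
    (hA : LaminarPair Z A) (hB : LaminarPair Z B) : LaminarPair Z Y := by
  simp only [LaminarPair, Set.disjoint_left, Set.subset_def] at *
  rcases hY with rfl | rfl | rfl | rfl <;> grind

theorem covers_mk {a b : V} {S : Set V} :
    Covers s(a, b) S ↔ (a ∈ S ∧ b ∉ S) ∨ (b ∈ S ∧ a ∉ S) := by
  constructor
  · rintro ⟨u, v, h, hu, hv⟩
    rcases Sym2.eq_iff.1 h with ⟨rfl, rfl⟩ | ⟨rfl, rfl⟩
    · exact Or.inl ⟨hu, hv⟩
    · exact Or.inr ⟨hu, hv⟩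
  · rintro (⟨h, h'⟩ | ⟨h, h'⟩)
    · exact ⟨a, b, rfl, h, h'⟩
    · exact ⟨b, a, Sym2.eq_swap, h, h'⟩

theorem not_covers_mk {a b : V} {S : Set V} (h : a ∈ S ↔ b ∈ S) : ¬ Covers s(a, b) S := by
  rw [covers_mk]
  tauto

theorem mem_delta {S : Set V} {g : Sym2 V} : g ∈ delta I S ↔ g ∈ I ∧ Covers g S := by
  simp [delta]

theorem IsCorner.covers {A B Y : Set V} (h : IsCorner A B Y) {g : Sym2 V} (hg : Covers g Y) :
    Covers g A ∨ Covers g B := by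
  induction g with
  | h a b =>
    simp only [covers_mk] at *
    rcases h with rfl | rfl | rfl | rfl <;> grind

theorem CoversFam.delta_nonempty (hI : CoversFam I F) {S : Set V} (hS : S ∈ F) :
    (delta I S).Nonempty :=
  Finset.card_pos.1 (hI S hS)

theorem CoversFam.witnessSet (hI : CoversFam I F) {S : Set V} (hS : S ∈ F) {e : Sym2 V}
    (h : ∀ g ∈ I, Covers g S → g = e) : WitnessSet F I S e := by
  refine ⟨hS, (hI.delta_nonempty hS).subset_singleton_iff.1 fun g hg => ?_⟩
  rw [mem_delta] at hg
  exact Finset.mem_singleton.2 (h g hg.1 hg.2)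

theorem MinimalCover.exists_witnessSet (h : MinimalCover I F) {e : Sym2 V} (he : e ∈ I) :
    ∃ S, WitnessSet F I S e := by
  have h' := h.2 _ (Finset.erase_ssubset he)
  simp only [CoversFam, not_forall] at h'
  obtain ⟨S, hS, hd⟩ := h'
  refine ⟨S, h.1.witnessSet hS fun g hg hgS => ?_⟩
  by_contra hne
  exact hd (Finset.card_pos.2 ⟨g, mem_delta.2 ⟨Finset.mem_erase.2 ⟨hne, hg⟩, hgS⟩⟩)

theorem WitnessSet.mem_and_covers {S : Set V} {e : Sym2 V} (h : WitnessSet F I S e) :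
    e ∈ I ∧ Covers e S :=
  mem_delta.1 (h.2 ▸ Finset.mem_singleton_self e)

theorem WitnessSet.eq_of_covers {S : Set V} {e g : Sym2 V} (h : WitnessSet F I S e)
    (hg : g ∈ I) (hc : Covers g S) : g = e :=
  Finset.mem_singleton.1 (h.2 ▸ mem_delta.2 ⟨hg, hc⟩)

/-- Given witness sets `A` of `s(u, v)` and `B` of `f`, either `A` can be replaced by a corner, or
`B` can be replaced by a corner whose shape depends on whether `B` contains `s(u, v)`. -/
theorem exists_corner_witnessSet (hP : Pliable F) (hI : CoversFam I F) {A B : Set V} {u v : V}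
    {f : Sym2 V} (hA : WitnessSet F I A s(u, v)) (hB : WitnessSet F I B f) (hne : f ≠ s(u, v)) :
    (∃ Y, IsCorner A B Y ∧ WitnessSet F I Y s(u, v)) ∨
    ∃ Y, WitnessSet F I Y f ∧
      ((u ∈ B ∧ v ∈ B ∧ (Y = A \ B ∨ Y = A ∪ B)) ∨
        (u ∉ B ∧ v ∉ B ∧ (Y = A ∩ B ∨ Y = B \ A))) := by
  have heB : ¬ Covers s(u, v) B := fun h => hne (hB.eq_of_covers hA.mem_and_covers.1 h).symm
  have hfA : ¬ Covers f A := fun h => hne (hA.eq_of_covers hB.mem_and_covers.1 h)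
  have key : ∀ Y, IsCorner A B Y → ∀ g ∈ I, Covers g Y → g = s(u, v) ∨ g = f :=
    fun Y hY g hg hgY => (hY.covers hgY).imp (hA.eq_of_covers hg) (hB.eq_of_covers hg)
  have witness_left : ∀ Y, IsCorner A B Y → Y ∈ F → ¬ Covers f Y →
      WitnessSet F I Y s(u, v) := fun Y hY hYF hf =>
    hI.witnessSet hYF fun g hg hgY => (key Y hY g hg hgY).resolve_right fun h => hf (h ▸ hgY)
  have witness_right : ∀ Y, IsCorner A B Y → Y ∈ F → ¬ Covers s(u, v) Y →
      WitnessSet F I Y f := fun Y hY hYF he =>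
    hI.witnessSet hYF fun g hg hgY => (key Y hY g hg hgY).resolve_left fun h => he (h ▸ hgY)
  have not_mem : ∀ Y, IsCorner A B Y → ¬ Covers s(u, v) Y → ¬ Covers f Y → Y ∉ F := by
    intro Y hY he hf hYF
    obtain ⟨g, hg⟩ := hI.delta_nonempty hYF
    rw [mem_delta] at hg
    rcases key Y hY g hg.1 hg.2 with rfl | rfl
    · exact he hg.2
    · exact hf hg.2
  have c1 : IsCorner A B (A ∩ B) := Or.inl rfl
  have c2 : IsCorner A B (A ∪ B) := Or.inr (Or.inl rfl)
  have c3 : IsCorner A B (A \ B) := Or.inr (Or.inr (Or.inl rfl))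
  have c4 : IsCorner A B (B \ A) := Or.inr (Or.inr (Or.inr rfl))
  have hPAB := hP A hA.1 B hB.1
  unfold AtLeastTwo at hPAB
  induction f with
  | h a b =>
    have huB : u ∈ B ↔ v ∈ B := by rw [covers_mk] at heB; tauto
    have haA : a ∈ A ↔ b ∈ A := by rw [covers_mk] at hfA; tauto
    by_cases h1 : u ∈ B <;> by_cases h2 : a ∈ A
    · have hD : A ∪ B ∉ F := not_mem _ c2 (not_covers_mk (by simp [← huB, h1]))
        (not_covers_mk (by simp [← haA, h2]))
      by_cases hY : B \ A ∈ F
      · exact Or.inl ⟨_, c4, witness_left _ c4 hY (not_covers_mk (by simp [← haA, h2]))⟩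
      · exact Or.inr ⟨_, witness_right _ c3 (by tauto) (not_covers_mk (by simp [← huB, h1])),
          by simp [← huB, h1]⟩
    · have hD : A \ B ∉ F := not_mem _ c3 (not_covers_mk (by simp [← huB, h1]))
        (not_covers_mk (by simp [← haA, h2]))
      by_cases hY : A ∩ B ∈ F
      · exact Or.inl ⟨_, c1, witness_left _ c1 hY (not_covers_mk (by simp [← haA, h2]))⟩
      · exact Or.inr ⟨_, witness_right _ c2 (by tauto) (not_covers_mk (by simp [← huB, h1])),
          by simp [← huB, h1]⟩
    · have hD : B \ A ∉ F := not_mem _ c4 (not_covers_mk (by simp [← huB, h1]))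
        (not_covers_mk (by simp [← haA, h2]))
      by_cases hY : A ∪ B ∈ F
      · exact Or.inl ⟨_, c2, witness_left _ c2 hY (not_covers_mk (by simp [← haA, h2]))⟩
      · exact Or.inr ⟨_, witness_right _ c1 (by tauto) (not_covers_mk (by simp [← huB, h1])),
          by simp [← huB, h1]⟩
    · have hD : A ∩ B ∉ F := not_mem _ c1 (not_covers_mk (by simp [← huB, h1]))
        (not_covers_mk (by simp [← haA, h2]))
      by_cases hY : A \ B ∈ F
      · exact Or.inl ⟨_, c3, witness_left _ c3 hY (not_covers_mk (by simp [← haA, h2]))⟩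
      · exact Or.inr ⟨_, witness_right _ c4 (by tauto) (not_covers_mk (by simp [← huB, h1])),
          by simp [← huB, h1]⟩

theorem laminarPair_of_corners {A B C Y Z : Set V} {u v : V} (hBC : LaminarPair B C)
    (hY : (u ∈ B ∧ v ∈ B ∧ (Y = A \ B ∨ Y = A ∪ B)) ∨
      (u ∉ B ∧ v ∉ B ∧ (Y = A ∩ B ∨ Y = B \ A)))
    (hZ : (u ∈ C ∧ v ∈ C ∧ (Z = A \ C ∨ Z = A ∪ C)) ∨
      (u ∉ C ∧ v ∉ C ∧ (Z = A ∩ C ∨ Z = C \ A))) : LaminarPair Y Z := by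
  simp only [LaminarPair, Set.disjoint_left, Set.subset_def] at *
  rcases hY with ⟨huB, hvB, rfl | rfl⟩ | ⟨huB, hvB, rfl | rfl⟩ <;>
    rcases hZ with ⟨huC, hvC, rfl | rfl⟩ | ⟨huC, hvC, rfl | rfl⟩ <;> grind

theorem exists_laminar_witness (hP : Pliable F) (hmin : MinimalCover I F)
    (J : Finset (Sym2 V)) (hJ : J ⊆ I) :
    ∃ w : Sym2 V → Set V, (∀ e ∈ J, WitnessSet F I (w e) e) ∧
      ∀ e ∈ J, ∀ f ∈ J, LaminarPair (w e) (w f) := by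
  induction J using Finset.induction_on with
  | empty => exact ⟨fun _ => ∅, by simp, by simp⟩
  | insert e J heJ ih =>
    obtain ⟨w, hw, hlam⟩ := ih fun x hx => hJ (Finset.mem_insert_of_mem hx)
    obtain ⟨A, hA, hAmin⟩ := WellFounded.has_min
      (measure fun S : Set V => (J.filter fun f => ¬ LaminarPair S (w f)).card).wf
      {S | WitnessSet F I S e} (hmin.exists_witnessSet (hJ (Finset.mem_insert_self e J)))
    obtain ⟨u, v, rfl, -, -⟩ := hA.mem_and_covers.2
    have key : ∀ f ∈ J, ∃ Y, WitnessSet F I Y f ∧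
        ((LaminarPair A (w f) ∧ Y = w f) ∨ (¬ LaminarPair A (w f) ∧ IsCorner A (w f) Y ∧
        ((u ∈ w f ∧ v ∈ w f ∧ (Y = A \ w f ∨ Y = A ∪ w f)) ∨
          (u ∉ w f ∧ v ∉ w f ∧ (Y = A ∩ w f ∨ Y = w f \ A))))) := by
      intro f hf
      by_cases hAf : LaminarPair A (w f)
      · exact ⟨w f, hw f hf, Or.inl ⟨hAf, rfl⟩⟩
      · rcases exists_corner_witnessSet hP hmin.1 hA (hw f hf) (fun h => heJ (h ▸ hf)) with
          ⟨Y, hY, hYe⟩ | ⟨Y, hYf, hY⟩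
        · refine absurd (Finset.card_lt_card ?_) (hAmin Y hYe)
          rw [Finset.ssubset_iff_of_subset]
          · exact ⟨f, by simp [hf, hAf], by simp [hY.laminarPair]⟩
          · intro g hg
            simp only [Finset.mem_filter] at hg ⊢
            exact ⟨hg.1, fun h => hg.2
              (LaminarPair.corner hAf hY h.symm (hlam g hg.1 f hf)).symm⟩
        · exact ⟨Y, hYf, Or.inr ⟨hAf, by unfold IsCorner; tauto, hY⟩⟩
    choose! y hyw hy using key
    have hAy : ∀ f ∈ J, LaminarPair A (y f) := by
      intro f hf
      rcases hy f hf with ⟨h, h'⟩ | ⟨h, h', -⟩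
      · rwa [h']
      · refine (IsCorner.laminarPair (A := w f) ?_).symm
        unfold IsCorner at *
        rw [Set.inter_comm, Set.union_comm]
        tauto
    have hyy : ∀ f ∈ J, ∀ g ∈ J, LaminarPair (y f) (y g) := by
      intro f hf g hg
      rcases hy f hf with ⟨h, h'⟩ | ⟨h, h', h''⟩ <;> rcases hy g hg with ⟨k, k'⟩ | ⟨k, k', k''⟩
      · rw [h', k']; exact hlam f hf g hg
      · rw [h']; exact LaminarPair.corner k k' h.symm (hlam f hf g hg)
      · rw [k']; exact (LaminarPair.corner h h' k.symm (hlam g hg f hf)).symm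
      · exact laminarPair_of_corners (hlam f hf g hg) h'' k''
    have hne : ∀ f ∈ J, f ≠ s(u, v) := fun f hf h => heJ (h ▸ hf)
    refine ⟨Function.update y s(u, v) A, ?_, ?_⟩
    · intro f hf
      rcases Finset.mem_insert.1 hf with rfl | hf
      · simpa using hA
      · simpa [hne f hf] using hyw f hf
    · intro f hf g hg
      rcases Finset.mem_insert.1 hf with rfl | hf <;> rcases Finset.mem_insert.1 hg with rfl | hg
      · exact LaminarPair.refl _
      · simpa [hne g hg] using hAy g hg
      · simpa [hne f hf] using (hAy f hf).symm
      · simpa [hne f hf, hne g hg] using hyy f hf g hg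

end

end SFEC

theorem stmt_6 {V : Type*} [Fintype V]
    (F : Set (Set V)) (hF : IsSetFamily F) (hP : Pliable F)
    (I : Finset (Sym2 V)) (hIe : ∀ e ∈ I, ¬ e.IsDiag) (hmin : MinimalCover I F) :
    ∃ L : Finset (Set V), WitnessFamily F I L ∧ Laminar L := by
  obtain ⟨w, hw, hlam⟩ := exists_laminar_witness hP hmin I subset_rfl
  refine ⟨I.image w, ⟨?_, ?_, ?_⟩, ?_⟩
  · intro S hS
    obtain ⟨e, he, rfl⟩ := Finset.mem_image.1 (Finset.mem_coe.1 hS)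
    exact (hw e he).1
  · refine Finset.card_image_of_injOn fun e he f hf hef => ?_
    exact (hw f hf).eq_of_covers he (hef ▸ (hw e he).mem_and_covers.2)
  · exact fun e he => ⟨w e, Finset.mem_image_of_mem w he, hw e he⟩
  · intro A hA B hB
    obtain ⟨e, he, rfl⟩ := Finset.mem_image.1 hA
    obtain ⟨f, hf, rfl⟩ := Finset.mem_image.1 hB
    exact hlam e he f hf
end

section
/- Let T = (V_T, E_T) be a finite tree with at least two vertices, rooted at r, and let R, W be a partition of V_T such that every w ∈ W \ {r} has at least 2 children. Then |E_T| ≤ 2|R| − 1. Furthermore, if r has at least 2 children then |E_T| ≤ 2(|R| − 1). -/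
open scoped Classical

open SFEC

/-- Summed over all vertices, the number of children is at most the number of edges. -/
theorem sum_ncard_children_le {V : Type*} [Fintype V] (G : SimpleGraph V) (r : V) :
    ∑ v, {x | G.Adj v x ∧ G.dist r x = G.dist r v + 1}.ncard ≤ G.edgeSet.ncard := by
  simp_rw [Set.ncard_eq_toFinset_card']
  rw [← Finset.card_sigma]
  refine Finset.card_le_card_of_injOn (fun p => s(p.1, p.2)) ?_ ?_
  · rintro ⟨v, x⟩ h
    simp only [Finset.coe_sigma, Set.mem_sigma_iff, Finset.mem_coe, Set.mem_toFinset,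
      Set.mem_ofPred_eq] at h
    simpa using h.2.1
  · rintro ⟨v, x⟩ h ⟨v', x'⟩ h' heq
    simp only [Finset.coe_sigma, Set.mem_sigma_iff, Finset.mem_coe, Set.mem_toFinset,
      Set.mem_ofPred_eq] at h h'
    rcases Sym2.eq_iff.mp heq with ⟨h1, h2⟩ | ⟨h1, h2⟩
    · simp only at h1 h2
      subst h1 h2
      rfl
    · simp only at h1 h2
      subst h1 h2
      omega

theorem stmt_7 {Vt : Type*} [Fintype Vt]
    (G : SimpleGraph Vt) (hT : G.IsTree) (hcard : 2 ≤ Fintype.card Vt) (r : Vt)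
    (R W : Set Vt) (hpart : R ∪ W = Set.univ) (hdisj : Disjoint R W)
    (hWch : ∀ w ∈ W, w ≠ r →
      2 ≤ {x | G.Adj w x ∧ G.dist r x = G.dist r w + 1}.ncard) :
    G.edgeSet.ncard ≤ 2 * R.ncard - 1 ∧
      (2 ≤ {x | G.Adj r x ∧ G.dist r x = 1}.ncard →
        G.edgeSet.ncard ≤ 2 * (R.ncard - 1)) := by
  have hE : G.edgeSet.ncard + 1 = Fintype.card Vt := by
    rw [Set.ncard_eq_toFinset_card']
    exact hT.card_edgeFinset
  have hRW : R.ncard + W.ncard = Fintype.card Vt := by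
    rw [← Set.ncard_union_eq hdisj, hpart, Set.ncard_univ, Nat.card_eq_fintype_card]
  have hroot : 1 ≤ {x | G.Adj r x ∧ G.dist r x = 1}.ncard := by
    have : Nontrivial Vt := Fintype.one_lt_card_iff_nontrivial.mp hcard
    obtain ⟨x, hx⟩ := hT.connected.preconnected.exists_adj_of_nontrivial r
    exact (Set.ncard_pos).mpr ⟨x, hx, SimpleGraph.dist_eq_one_iff_adj.mpr hx⟩
  have hsum := sum_ncard_children_le G r
  rw [← Finset.add_sum_erase _ _ (Finset.mem_univ r)] at hsum
  simp only [SimpleGraph.dist_self, zero_add] at hsum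
  have hW : 2 * (W \ {r}).ncard ≤ ∑ v ∈ Finset.univ.erase r,
      {x | G.Adj v x ∧ G.dist r x = G.dist r v + 1}.ncard := by
    rw [Set.ncard_eq_toFinset_card', mul_comm, ← smul_eq_mul]
    refine (Finset.card_nsmul_le_sum _ _ _ fun w hw => ?_).trans
      (Finset.sum_le_sum_of_subset fun w hw => ?_)
    · have : w ∈ W ∧ w ≠ r := by simpa using hw
      exact hWch w this.1 this.2
    · have : w ∈ W ∧ w ≠ r := by simpa using hw
      simpa using this.2
  have hWr : W.ncard ≤ (W \ {r}).ncard + 1 := by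
    simpa using Set.ncard_le_ncard_sdiff_add_ncard W {r}
  omega
end

section
/- Let F be a γ-pliable set family on a finite set V, let I be an inclusion-minimal cover of F such that every edge of I covers some F-core, and let L be a laminar witness family for I, augmented with the set V. If S ∈ L is hollow and A is the unique child of S in L (the unique maximal member of L properly contained in S), then S \ A contains no member of F. -/
open scoped Classical

namespace SFEC

/-- In a finite ground set, every member of a family contains a core. -/
theorem exists_core_subset {V : Type*} [Finite V] {F : Set (Set V)} {B : Set V} (hB : B ∈ F) :
    ∃ C, C ⊆ B ∧ Core F C := by
  obtain ⟨C, hCB, hC⟩ := (Set.toFinite F).exists_le_minimal hB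
  exact ⟨C, hCB, hC.prop, fun A hA hAC => Set.Subset.antisymm hAC (hC.le_of_le hA hAC)⟩

/-- Augmenting a laminar family with the ground set keeps it laminar. -/
theorem Laminar.insert_univ {V : Type*} {L : Finset (Set V)} (hL : Laminar L) :
    Laminar (insert Set.univ L) := by
  intro A hA B hB
  rcases Finset.mem_insert.1 hA with rfl | hA
  · exact Or.inr (Or.inl (Set.subset_univ B))
  rcases Finset.mem_insert.1 hB with rfl | hB
  · exact Or.inl (Set.subset_univ A)
  exact hL A hA B hB

/-- In a laminar family, a member with a unique child owns every nonempty set that it contains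
and that is disjoint from the child. -/
theorem UniqueChild.owns {V : Type*} {L : Finset (Set V)} {A S C : Set V} (hL : Laminar L)
    (hA : UniqueChild L A S) (hS : S ∈ L) (hne : C.Nonempty) (hC : C ⊆ S \ A) : Owns L S C := by
  refine ⟨hS, fun x hx => (hC hx).1, fun T hT hCT => ?_⟩
  obtain ⟨x, hx⟩ := hne
  rcases hL S hS T hT with h | h | h
  · exact h
  · by_contra hST
    exact (hC hx).2 (hA.2.2 T hT ⟨h, hST⟩ (hCT hx))
  · exact absurd (hCT hx) (Set.disjoint_left.1 h (hC hx).1)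

end SFEC

open SFEC

theorem stmt_8
    {V : Type*} [Fintype V]
    (F : Set (Set V)) (hF : IsSetFamily F) (hgp : GammaPliable F)
    (I : Finset (Sym2 V)) (hIe : ∀ e ∈ I, ¬ e.IsDiag)
    (hmin : MinimalCover I F)
    (hcov : ∀ e ∈ I, ∃ C : Set V, Core F C ∧ Covers e C)
    (L : Finset (Set V)) (hWF : WitnessFamily F I L) (hlam : Laminar L)
    (Sh A : Set V)
    (hhollow : Hollow F (insert Set.univ L) Sh)
    (hchild : UniqueChild (insert Set.univ L) A Sh) :
    ∀ B ∈ F, ¬ B ⊆ Sh \ A := by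
  intro B hB hBS
  obtain ⟨C, hCB, hC⟩ := exists_core_subset hB
  have hne : C.Nonempty := Set.nonempty_iff_ne_empty.2 fun h => hF.1 (h ▸ hC.1)
  exact hhollow.2 C hC (hchild.owns hlam.insert_univ hhollow.1 hne (hCB.trans hBS))
end
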